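/- arXiv:0904.0316 — 2 statements merged into one kernel-verified Lean document; each statement's English description precedes it below -/
import Mathlib

section
/- For every integer s ≥ 1 and every bounded measurable function h : X → ℝ with φ_{s|s}(h) = 0, Σ_{r=0}^{s} V_{χ,r,s}[h] ≤ (σ₊/(c₋·σ₋)) · sup_{r≥0} ‖ω_r‖_∞·‖ϑ_r‖_∞ · osc(h)² / (1 − ρ²). -/
open MeasureTheory

noncomputable section

variable {X : Type*} [MeasurableSpace X]

/-- `ell ν q g s n x y` is the kernel density `ℓ_{s, s+n+1}(x, y)`:
`ℓ_{s,s+1}(x,y) = q(x,y) g_{s+1}(y)` and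
`ℓ_{s,t+1}(x,y) = ∫ ℓ_{s,t}(x,z) q(z,y) g_{t+1}(y) ν(dz)`. -/
def ell (ν : Measure X) (q : X → X → ℝ) (g : ℕ → X → ℝ) (s : ℕ) : ℕ → X → X → ℝ
  | 0 => fun x y => q x y * g (s + 1) y
  | n + 1 => fun x y => ∫ z, ell ν q g s n x z * (q z y * g (s + n + 2) y) ∂ν

/-- `ℓ_{s,t}` for `s < t`. -/
def ellST (ν : Measure X) (q : X → X → ℝ) (g : ℕ → X → ℝ) (s t : ℕ) : X → X → ℝ :=
  ell ν q g s (t - s - 1)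

/-- `L_{s,t}(x,h) = ∫ ℓ_{s,t}(x,y) h(y) ν(dy)`, with the convention `L_{t,t}(x,h) = h x`. -/
def Lop (ν : Measure X) (q : X → X → ℝ) (g : ℕ → X → ℝ) (s t : ℕ) (x : X) (h : X → ℝ) : ℝ :=
  if s < t then ∫ y, ellST ν q g s t x y * h y ∂ν else h x

/-- filtering distribution `φ_{t|t}(h)` (for `t = 0` this is `χ(g₀h)/χ(g₀)`). -/
def philt (ν χ : Measure X) (q : X → X → ℝ) (g : ℕ → X → ℝ) (t : ℕ) (h : X → ℝ) : ℝ :=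
  (∫ x, g 0 x * Lop ν q g 0 t x h ∂χ) / ∫ x, g 0 x * Lop ν q g 0 t x (fun _ => 1) ∂χ

/-- one-step predictor `φ_{t|t-1}(h) = φ_{t-1|t-1}(x ↦ ∫ q(x,y)h(y)ν(dy))`. -/
def phipred (ν χ : Measure X) (q : X → X → ℝ) (g : ℕ → X → ℝ) (t : ℕ) (h : X → ℝ) : ℝ :=
  philt ν χ q g (t - 1) (fun x => ∫ y, q x y * h y ∂ν)

/-- importance weight `ω_t(x,x') = q(x,x') g_t(x') / (ϑ_t(x) p_t(x,x'))`. -/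
def omegaFn (q : X → X → ℝ) (g : ℕ → X → ℝ) (ϑ : ℕ → X → ℝ) (p : ℕ → X → X → ℝ)
    (t : ℕ) (x y : X) : ℝ :=
  q x y * g t y / (ϑ t x * p t x y)

/-- oscillation of a function -/
def osc {Y : Type*} (h : Y → ℝ) : ℝ := ⨆ pr : Y × Y, |h pr.1 - h pr.2|

/-- `V_{χ,0,s}[h]`, where `d0` is the density `dχ/dρ₀`. -/
def V0 (ν ρ₀ χ : Measure X) (q : X → X → ℝ) (g : ℕ → X → ℝ) (d0 : X → ℝ)
    (s : ℕ) (h : X → ℝ) : ℝ :=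
  (∫ x, (d0 x * g 0 x) ^ 2 * (Lop ν q g 0 s x h) ^ 2 ∂ρ₀) /
    (∫ x, g 0 x * Lop ν q g 0 s x (fun _ => 1) ∂χ) ^ 2

/-- `V_{χ,r,s}[h]` for `1 ≤ r ≤ s`. -/
def Vr (ν χ : Measure X) (q : X → X → ℝ) (g : ℕ → X → ℝ)
    (ϑ : ℕ → X → ℝ) (p : ℕ → X → X → ℝ) (r s : ℕ) (h : X → ℝ) : ℝ :=
  philt ν χ q g (r - 1)
      (fun x => ϑ r x * ∫ y, p r x y * omegaFn q g ϑ p r x y ^ 2 * Lop ν q g r s y h ^ 2 ∂ν) *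
    philt ν χ q g (r - 1) (ϑ r) /
      phipred ν χ q g r (fun x => g r x * Lop ν q g r s x fun _ => 1) ^ 2

/-- `V_{χ,r,s}[h]` for `0 ≤ r ≤ s`. -/
def Vrs (ν ρ₀ χ : Measure X) (q : X → X → ℝ) (g : ℕ → X → ℝ) (d0 : X → ℝ)
    (ϑ : ℕ → X → ℝ) (p : ℕ → X → X → ℝ) (r s : ℕ) (h : X → ℝ) : ℝ :=
  if r = 0 then V0 ν ρ₀ χ q g d0 s h else Vr ν χ q g ϑ p r s h

/-- `‖ω_r‖_∞`, with the convention `ω₀ = (dχ/dρ₀)·g₀`. -/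
def supOmega (q : X → X → ℝ) (g : ℕ → X → ℝ) (d0 : X → ℝ)
    (ϑ : ℕ → X → ℝ) (p : ℕ → X → X → ℝ) (r : ℕ) : ℝ :=
  if r = 0 then ⨆ x, |d0 x * g 0 x| else ⨆ pr : X × X, |omegaFn q g ϑ p r pr.1 pr.2|

/-- `‖ϑ_r‖_∞`, with the convention `ϑ₀ ≡ 1`. -/
def supTheta (ϑ : ℕ → X → ℝ) (r : ℕ) : ℝ :=
  if r = 0 then 1 else ⨆ x, |ϑ r x|

end

section FilterStability

variable {X : Type*} [MeasurableSpace X]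

/-- Bounded measurable functions. -/
def BddMeas {Y : Type*} [MeasurableSpace Y] (f : Y → ℝ) : Prop :=
  Measurable f ∧ ∃ K, ∀ x, |f x| ≤ K

namespace BddMeas

variable {Y : Type*} [MeasurableSpace Y] {f f' : Y → ℝ}

theorem const (c : ℝ) : BddMeas fun _ : Y => c :=
  ⟨measurable_const, |c|, fun _ => le_rfl⟩

theorem mul (hf : BddMeas f) (hf' : BddMeas f') : BddMeas fun x => f x * f' x := by
  obtain ⟨hm, K, hK⟩ := hf
  obtain ⟨hm', K', hK'⟩ := hf'
  refine ⟨hm.mul hm', K * K', fun x => ?_⟩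
  rw [abs_mul]
  exact mul_le_mul (hK x) (hK' x) (abs_nonneg _) ((abs_nonneg _).trans (hK x))

theorem integrable (hf : BddMeas f) (μ : Measure Y) [IsFiniteMeasure μ] : Integrable f μ := by
  obtain ⟨hm, K, hK⟩ := hf
  exact Integrable.of_bound hm.aestronglyMeasurable K (Filter.Eventually.of_forall hK)

theorem comp {Z : Type*} [MeasurableSpace Z] (hf : BddMeas f) {k : Z → Y} (hk : Measurable k) :
    BddMeas fun z => f (k z) := by
  obtain ⟨hm, K, hK⟩ := hf
  exact ⟨hm.comp hk, K, fun z => hK _⟩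

theorem integral_prod_right {Z : Type*} [MeasurableSpace Z] {F : Y → Z → ℝ}
    (hF : BddMeas fun pr : Y × Z => F pr.1 pr.2) (μ : Measure Z) [IsProbabilityMeasure μ] :
    BddMeas fun y => ∫ z, F y z ∂μ := by
  obtain ⟨hm, K, hK⟩ := hF
  refine ⟨(hm.stronglyMeasurable.integral_prod_right (ν := μ)).measurable, K, fun y => ?_⟩
  have := norm_integral_le_of_norm_le_const (μ := μ) (f := fun z => F y z) (C := K)
    (Filter.Eventually.of_forall fun z => hK (y, z))
  simpa using this

end BddMeas

/-- A mixing transition density `q` with uniformly bounded potentials `g`, each of them charged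
by every one-step transition. -/
structure MixingModel (ν : Measure X) (q : X → X → ℝ) (g : ℕ → X → ℝ) (σm σp cm : ℝ) : Prop where
  prob : IsProbabilityMeasure ν
  lower_pos : 0 < σm
  charge_pos : 0 < cm
  q_measurable : Measurable fun pr : X × X => q pr.1 pr.2
  lower_le : ∀ x y, σm ≤ q x y
  le_upper : ∀ x y, q x y ≤ σp
  g_bdd : ∀ t, BddMeas (g t)
  g_nonneg : ∀ t x, 0 ≤ g t x
  charge : ∀ t, 1 ≤ t → ∀ x, cm ≤ ∫ y, q x y * g t y ∂ν

/-- The one-step unnormalized transition `f ↦ ∫ q(·,y) g_t(y) f(y) ν(dy)`. -/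
noncomputable def stepOp (ν : Measure X) (q : X → X → ℝ) (g : ℕ → X → ℝ) (t : ℕ) (f : X → ℝ)
    (x : X) : ℝ :=
  ∫ y, q x y * g t y * f y ∂ν

/-- The composition of the one-step transitions at times `s + 1, …, s + n`. -/
noncomputable def iterOp (ν : Measure X) (q : X → X → ℝ) (g : ℕ → X → ℝ) :
    ℕ → ℕ → (X → ℝ) → X → ℝ
  | _, 0, f => f
  | s, n + 1, f => stepOp ν q g (s + 1) (iterOp ν q g (s + 1) n f)

theorem iterOp_add (ν : Measure X) (q : X → X → ℝ) (g : ℕ → X → ℝ) (s m n : ℕ) (f : X → ℝ) :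
    iterOp ν q g s (m + n) f = iterOp ν q g s m (iterOp ν q g (s + m) n f) := by
  induction m generalizing s with
  | zero => simp [iterOp]
  | succ m ih =>
    rw [Nat.succ_add m n]
    simp only [iterOp]
    rw [ih (s + 1), show s + 1 + m = s + (m + 1) by ring]

namespace MixingModel

variable {ν : Measure X} {q : X → X → ℝ} {g : ℕ → X → ℝ} {σm σp cm : ℝ}

theorem nonempty (H : MixingModel ν q g σm σp cm) : Nonempty X := by
  have := H.prob
  exact nonempty_of_isProbabilityMeasure ν

theorem q_pos (H : MixingModel ν q g σm σp cm) (x y : X) : 0 < q x y :=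
  H.lower_pos.trans_le (H.lower_le x y)

theorem upper_pos (H : MixingModel ν q g σm σp cm) : 0 < σp := by
  obtain ⟨x⟩ := H.nonempty
  exact (H.q_pos x x).trans_le (H.le_upper x x)

theorem lower_le_upper (H : MixingModel ν q g σm σp cm) : σm ≤ σp := by
  obtain ⟨x⟩ := H.nonempty
  exact (H.lower_le x x).trans (H.le_upper x x)

theorem q_bdd (H : MixingModel ν q g σm σp cm) : BddMeas fun pr : X × X => q pr.1 pr.2 :=
  ⟨H.q_measurable, σp, fun pr => by
    rw [abs_of_pos (H.q_pos _ _)]; exact H.le_upper _ _⟩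

theorem qg_bdd (H : MixingModel ν q g σm σp cm) (t : ℕ) :
    BddMeas fun pr : X × X => q pr.1 pr.2 * g t pr.2 :=
  H.q_bdd.mul ((H.g_bdd t).comp measurable_snd)

theorem step_integrand_bdd (H : MixingModel ν q g σm σp cm) (t : ℕ) {f : X → ℝ} (hf : BddMeas f)
    (x : X) : BddMeas fun y => q x y * g t y * f y :=
  ((H.qg_bdd t).comp measurable_prodMk_left).mul hf

theorem stepOp_bdd (H : MixingModel ν q g σm σp cm) (t : ℕ) {f : X → ℝ} (hf : BddMeas f) :
    BddMeas (stepOp ν q g t f) := by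
  have := H.prob
  exact ((H.qg_bdd t).mul (hf.comp measurable_snd)).integral_prod_right ν

theorem iterOp_bdd (H : MixingModel ν q g σm σp cm) (s n : ℕ) {f : X → ℝ} (hf : BddMeas f) :
    BddMeas (iterOp ν q g s n f) := by
  induction n generalizing s with
  | zero => exact hf
  | succ n ih => exact H.stepOp_bdd _ (ih _)

theorem stepOp_mono (H : MixingModel ν q g σm σp cm) (t : ℕ) {f f' : X → ℝ} (hf : BddMeas f)
    (hf' : BddMeas f') (hle : ∀ x, f x ≤ f' x) (x : X) :
    stepOp ν q g t f x ≤ stepOp ν q g t f' x := by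
  have := H.prob
  refine integral_mono ((H.step_integrand_bdd t hf x).integrable ν)
    ((H.step_integrand_bdd t hf' x).integrable ν) fun y => ?_
  exact mul_le_mul_of_nonneg_left (hle y) (mul_nonneg (H.q_pos x y).le (H.g_nonneg t y))

theorem iterOp_mono (H : MixingModel ν q g σm σp cm) (s n : ℕ) {f f' : X → ℝ} (hf : BddMeas f)
    (hf' : BddMeas f') (hle : ∀ x, f x ≤ f' x) (x : X) :
    iterOp ν q g s n f x ≤ iterOp ν q g s n f' x := by
  induction n generalizing s x with
  | zero => exact hle x
  | succ n ih =>
    exact H.stepOp_mono _ (H.iterOp_bdd _ _ hf) (H.iterOp_bdd _ _ hf') (ih (s + 1)) x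

theorem _root_.stepOp_const_mul (t : ℕ) (c : ℝ) (f : X → ℝ) :
    stepOp ν q g t (fun x => c * f x) = fun x => c * stepOp ν q g t f x := by
  funext x
  simp only [stepOp]
  rw [← integral_const_mul]
  exact integral_congr_ae (Filter.Eventually.of_forall fun y => by ring)

theorem _root_.iterOp_const_mul (s n : ℕ) (c : ℝ) (f : X → ℝ) :
    iterOp ν q g s n (fun x => c * f x) = fun x => c * iterOp ν q g s n f x := by
  induction n generalizing s with
  | zero => rfl
  | succ n ih => simp only [iterOp, ih, stepOp_const_mul]

theorem const_mul_le_stepOp (H : MixingModel ν q g σm σp cm) {t : ℕ} (ht : 1 ≤ t) {f : X → ℝ}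
    (hf : BddMeas f) {c : ℝ} (hc : 0 ≤ c) (hle : ∀ x, c ≤ f x) (x : X) :
    cm * c ≤ stepOp ν q g t f x := by
  refine le_trans ?_ (H.stepOp_mono t (BddMeas.const c) hf hle x)
  rw [stepOp, integral_mul_const]
  exact mul_le_mul_of_nonneg_right (H.charge t ht x) hc

theorem exists_pos_le_iterOp_one (H : MixingModel ν q g σm σp cm) (s n : ℕ) :
    ∃ c > 0, ∀ x, c ≤ iterOp ν q g s n (fun _ => 1) x := by
  induction n generalizing s with
  | zero => exact ⟨1, one_pos, fun _ => le_rfl⟩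
  | succ n ih =>
    obtain ⟨c, hc, hle⟩ := ih (s + 1)
    exact ⟨cm * c, mul_pos H.charge_pos hc, H.const_mul_le_stepOp (by omega)
      (H.iterOp_bdd _ _ (BddMeas.const 1)) hc.le hle⟩

theorem iterOp_one_pos (H : MixingModel ν q g σm σp cm) (s n : ℕ) (x : X) :
    0 < iterOp ν q g s n (fun _ => 1) x := by
  obtain ⟨c, hc, hle⟩ := H.exists_pos_le_iterOp_one s n
  exact hc.trans_le (hle x)

theorem g_mul_integrable (H : MixingModel ν q g σm σp cm) (t : ℕ) {f : X → ℝ} (hf : BddMeas f) :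
    Integrable (fun y => g t y * f y) ν := by
  have := H.prob
  exact ((H.g_bdd t).mul hf).integrable ν

theorem stepOp_le (H : MixingModel ν q g σm σp cm) (t : ℕ) {f : X → ℝ} (hf : BddMeas f)
    (hf0 : ∀ x, 0 ≤ f x) (x : X) : stepOp ν q g t f x ≤ σp * ∫ y, g t y * f y ∂ν := by
  have := H.prob
  rw [← integral_const_mul]
  refine integral_mono ((H.step_integrand_bdd t hf x).integrable ν)
    ((H.g_mul_integrable t hf).const_mul _) fun y => ?_
  simp only [mul_assoc]
  exact mul_le_mul_of_nonneg_right (H.le_upper x y) (mul_nonneg (H.g_nonneg t y) (hf0 y))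

theorem le_stepOp (H : MixingModel ν q g σm σp cm) (t : ℕ) {f : X → ℝ} (hf : BddMeas f)
    (hf0 : ∀ x, 0 ≤ f x) (x : X) : σm * ∫ y, g t y * f y ∂ν ≤ stepOp ν q g t f x := by
  have := H.prob
  rw [← integral_const_mul]
  refine integral_mono ((H.g_mul_integrable t hf).const_mul _)
    ((H.step_integrand_bdd t hf x).integrable ν) fun y => ?_
  simp only [mul_assoc]
  exact mul_le_mul_of_nonneg_right (H.lower_le x y) (mul_nonneg (H.g_nonneg t y) (hf0 y))

/-- The total masses from different starting points are comparable. -/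
theorem exists_iterOp_one_le (H : MixingModel ν q g σm σp cm) (s n : ℕ) :
    ∃ S > 0, ∀ x, iterOp ν q g s n (fun _ => 1) x ≤ S ∧
      σm / σp * S ≤ iterOp ν q g s n (fun _ => 1) x := by
  have hσp := H.upper_pos
  cases n with
  | zero =>
    refine ⟨1, one_pos, fun x => ⟨le_rfl, ?_⟩⟩
    simpa [iterOp] using (div_le_one hσp).2 H.lower_le_upper
  | succ n =>
    have hb := H.iterOp_bdd (s + 1) n (BddMeas.const 1)
    have hpos := fun x => (H.iterOp_one_pos (s + 1) n x).le
    refine ⟨σp * ∫ y, g (s + 1) y * iterOp ν q g (s + 1) n (fun _ => 1) y ∂ν, ?_,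
      fun x => ⟨H.stepOp_le _ hb hpos x, ?_⟩⟩
    · obtain ⟨x⟩ := H.nonempty
      exact (H.iterOp_one_pos s (n + 1) x).trans_le (H.stepOp_le _ hb hpos x)
    · rw [← mul_assoc, div_mul_cancel₀ _ hσp.ne']
      exact H.le_stepOp _ hb hpos x

theorem stepOp_sub (H : MixingModel ν q g σm σp cm) (t : ℕ) {f f' : X → ℝ} (hf : BddMeas f)
    (hf' : BddMeas f') (x : X) :
    stepOp ν q g t (fun y => f y - f' y) x = stepOp ν q g t f x - stepOp ν q g t f' x := by
  have := H.prob
  simp only [stepOp]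
  rw [← integral_sub ((H.step_integrand_bdd t hf x).integrable ν)
    ((H.step_integrand_bdd t hf' x).integrable ν)]
  simp only [mul_sub]

/-- One-sided Doeblin estimate. -/
theorem doeblin_le (H : MixingModel ν q g σm σp cm) (t : ℕ) {u v : X → ℝ} (hu : BddMeas u)
    (hv : BddMeas v) (hv0 : ∀ x, 0 ≤ v x) {m a : ℝ} (hm : ∀ x, m * v x ≤ u x)
    (ha : a * ∫ y, g t y * v y ∂ν = ∫ y, g t y * u y ∂ν) (hma : m ≤ a) (x : X) :
    (m + σm / σp * (a - m)) * stepOp ν q g t v x ≤ stepOp ν q g t u x := by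
  have hmv : BddMeas fun y => m * v y := (BddMeas.const m).mul hv
  have hsub : BddMeas fun y => u y - m * v y := by
    obtain ⟨h1, K, hK⟩ := hu
    obtain ⟨h2, K', hK'⟩ := hmv
    exact ⟨h1.sub h2, K + K', fun y => (abs_sub _ _).trans (add_le_add (hK y) (hK' y))⟩
  have h1 := H.le_stepOp t hsub (fun y => sub_nonneg.2 (hm y)) x
  rw [H.stepOp_sub t hu hmv, stepOp_const_mul] at h1
  have h2 : ∫ y, g t y * (u y - m * v y) ∂ν = (a - m) * ∫ y, g t y * v y ∂ν := by
    rw [sub_mul, ha, ← integral_const_mul,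
      ← integral_sub (H.g_mul_integrable t hu) ((H.g_mul_integrable t hv).const_mul _)]
    exact integral_congr_ae (Filter.Eventually.of_forall fun y => by ring)
  rw [h2] at h1
  have h3 := mul_le_mul_of_nonneg_left (H.stepOp_le t hv hv0 x)
    (mul_nonneg (div_nonneg H.lower_pos.le H.upper_pos.le) (sub_nonneg.2 hma))
  have h4 : σm / σp * (a - m) * (σp * ∫ y, g t y * v y ∂ν)
      = σm * ((a - m) * ∫ y, g t y * v y ∂ν) := by
    have := H.upper_pos.ne'
    field_simp
  linarith

/-- The normalized operators contract oscillations geometrically. -/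
theorem exists_iterOp_enclosure (H : MixingModel ν q g σm σp cm) {f : X → ℝ} (hf : BddMeas f)
    {m₀ M₀ : ℝ} (hm₀ : ∀ x, m₀ ≤ f x) (hM₀ : ∀ x, f x ≤ M₀) (s n : ℕ) :
    ∃ m M, M - m = (1 - σm / σp) ^ n * (M₀ - m₀) ∧
      ∀ x, m * iterOp ν q g s n (fun _ => 1) x ≤ iterOp ν q g s n f x ∧
        iterOp ν q g s n f x ≤ M * iterOp ν q g s n (fun _ => 1) x := by
  induction n generalizing s with
  | zero => exact ⟨m₀, M₀, by simp, fun x => by simpa [iterOp] using ⟨hm₀ x, hM₀ x⟩⟩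
  | succ n ih =>
    obtain ⟨m, M, hMm, hb⟩ := ih (s + 1)
    set u := iterOp ν q g (s + 1) n f with hu_def
    set v := iterOp ν q g (s + 1) n (fun _ => 1) with hv_def
    have hu : BddMeas u := H.iterOp_bdd _ _ hf
    have hv : BddMeas v := H.iterOp_bdd _ _ (BddMeas.const 1)
    have hv0 : ∀ x, 0 ≤ v x := fun x => (H.iterOp_one_pos _ _ x).le
    obtain ⟨x₀⟩ := H.nonempty
    have hW : 0 < ∫ y, g (s + 1) y * v y ∂ν := by
      have h1 := (H.iterOp_one_pos s (n + 1) x₀).trans_le (H.stepOp_le _ hv hv0 x₀)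
      exact pos_of_mul_pos_right h1 H.upper_pos.le
    set W := ∫ y, g (s + 1) y * v y ∂ν with hW_def
    obtain ⟨a, ha⟩ : ∃ a, a * W = ∫ y, g (s + 1) y * u y ∂ν := ⟨_, div_mul_cancel₀ _ hW.ne'⟩
    have hma : m ≤ a := by
      refine le_of_mul_le_mul_right ?_ hW
      rw [ha, hW_def, ← integral_const_mul]
      refine integral_mono ((H.g_mul_integrable _ hv).const_mul _) (H.g_mul_integrable _ hu)
        fun y => ?_
      have := mul_le_mul_of_nonneg_left (hb y).1 (H.g_nonneg (s + 1) y)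
      simp only
      linarith
    have haM : a ≤ M := by
      refine le_of_mul_le_mul_right ?_ hW
      rw [ha, hW_def, ← integral_const_mul]
      refine integral_mono (H.g_mul_integrable _ hu) ((H.g_mul_integrable _ hv).const_mul _)
        fun y => ?_
      have := mul_le_mul_of_nonneg_left (hb y).2 (H.g_nonneg (s + 1) y)
      simp only
      linarith
    refine ⟨m + σm / σp * (a - m), M + σm / σp * (a - M), ?_, fun x => ⟨?_, ?_⟩⟩
    · rw [pow_succ, mul_right_comm, ← hMm]
      ring
    · exact H.doeblin_le (s + 1) hu hv hv0 (fun y => (hb y).1) ha hma x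
    · have hneg : BddMeas fun y => -1 * u y := (BddMeas.const (-1)).mul hu
      have hlow := H.doeblin_le (s + 1) (m := -M) (a := -a) hneg hv hv0
        (fun y => by linarith [(hb y).2]) (by
          rw [← hW_def, neg_mul, ha, ← integral_neg]
          exact integral_congr_ae (Filter.Eventually.of_forall fun y => by ring))
        (by linarith) x
      rw [stepOp_const_mul] at hlow
      simp only [iterOp, ← hu_def, ← hv_def]
      linarith

theorem ell_bdd (H : MixingModel ν q g σm σp cm) (s n : ℕ) :
    BddMeas fun pr : X × X => ell ν q g s n pr.1 pr.2 := by
  have := H.prob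
  induction n with
  | zero => exact H.qg_bdd _
  | succ n ih =>
    refine BddMeas.integral_prod_right
      (F := fun (pr : X × X) z => ell ν q g s n pr.1 z * (q z pr.2 * g (s + n + 2) pr.2)) ?_ ν
    exact (ih.comp (k := fun w : (X × X) × X => (w.1.1, w.2)) (by fun_prop)).mul
      ((H.qg_bdd (s + n + 2)).comp (k := fun w : (X × X) × X => (w.2, w.1.2)) (by fun_prop))

theorem integral_ell_mul (H : MixingModel ν q g σm σp cm) (s n : ℕ) {f : X → ℝ}
    (hf : BddMeas f) (x : X) :
    ∫ y, ell ν q g s n x y * f y ∂ν = iterOp ν q g s (n + 1) f x := by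
  have := H.prob
  induction n generalizing f with
  | zero => rfl
  | succ n ih =>
    have hstep := H.stepOp_bdd (s + n + 2) hf
    have hiter : iterOp ν q g s (n + 1 + 1) f
        = iterOp ν q g s (n + 1) (stepOp ν q g (s + n + 2) f) := by
      rw [iterOp_add ν q g s (n + 1) 1 f]
      rfl
    have hint : BddMeas fun pr : X × X =>
        ell ν q g s n x pr.2 * (q pr.2 pr.1 * g (s + n + 2) pr.1) * f pr.1 :=
      (((H.ell_bdd s n).comp (k := fun w : X × X => (x, w.2)) (by fun_prop)).mul
        ((H.qg_bdd (s + n + 2)).comp (k := fun w : X × X => (w.2, w.1)) (by fun_prop))).mul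
        (hf.comp measurable_fst)
    rw [hiter, ← ih hstep]
    simp only [ell, stepOp, ← integral_mul_const, ← integral_const_mul]
    rw [integral_integral_swap (hint.integrable _)]
    simp only [mul_assoc]

theorem Lop_eq_iterOp (H : MixingModel ν q g σm σp cm) (s n : ℕ) {f : X → ℝ} (hf : BddMeas f)
    (x : X) : Lop ν q g s (s + n) x f = iterOp ν q g s n f x := by
  cases n with
  | zero => simp [Lop, iterOp]
  | succ n =>
    rw [← H.integral_ell_mul s n hf, Lop, if_pos (by omega), ellST,
      show s + (n + 1) - s - 1 = n by omega]

section Filtering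

variable {χ : Measure X}

theorem philt_eq (H : MixingModel ν q g σm σp cm) (t : ℕ) {f : X → ℝ} (hf : BddMeas f) :
    philt ν χ q g t f = (∫ x, g 0 x * iterOp ν q g 0 t f x ∂χ) /
      ∫ x, g 0 x * iterOp ν q g 0 t (fun _ => 1) x ∂χ := by
  have h1 := fun x => H.Lop_eq_iterOp 0 t hf x
  have h2 := fun x => H.Lop_eq_iterOp 0 t (BddMeas.const 1) x
  simp only [zero_add] at h1 h2
  simp only [philt, h1, h2]

theorem philt_const_mul (H : MixingModel ν q g σm σp cm) (t : ℕ) (c : ℝ)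
    {f : X → ℝ} (hf : BddMeas f) :
    philt ν χ q g t (fun x => c * f x) = c * philt ν χ q g t f := by
  rw [H.philt_eq t hf, H.philt_eq t ((BddMeas.const c).mul hf), iterOp_const_mul, ← mul_div_assoc,
    ← integral_const_mul]
  congr 1
  exact integral_congr_ae (Filter.Eventually.of_forall fun y => by ring)

variable [IsProbabilityMeasure χ]

theorem init_integrable (H : MixingModel ν q g σm σp cm) (t : ℕ) {f : X → ℝ}
    (hf : BddMeas f) : Integrable (fun x => g 0 x * iterOp ν q g 0 t f x) χ :=
  ((H.g_bdd 0).mul (H.iterOp_bdd 0 t hf)).integrable χ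

theorem init_mass_pos (H : MixingModel ν q g σm σp cm) (hχ : cm ≤ ∫ x, g 0 x ∂χ) (t : ℕ) :
    0 < ∫ x, g 0 x * iterOp ν q g 0 t (fun _ => 1) x ∂χ := by
  obtain ⟨c, hc, hle⟩ := H.exists_pos_le_iterOp_one 0 t
  have h1 : (∫ x, g 0 x ∂χ) * c ≤ ∫ x, g 0 x * iterOp ν q g 0 t (fun _ => 1) x ∂χ := by
    rw [← integral_mul_const]
    exact integral_mono (((H.g_bdd 0).integrable χ).mul_const _)
      (H.init_integrable t (BddMeas.const 1))
      fun x => mul_le_mul_of_nonneg_left (hle x) (H.g_nonneg 0 x)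
  exact (mul_pos (H.charge_pos.trans_le hχ) hc).trans_le h1

theorem philt_mono (H : MixingModel ν q g σm σp cm) (hχ : cm ≤ ∫ x, g 0 x ∂χ) (t : ℕ)
    {f f' : X → ℝ} (hf : BddMeas f) (hf' : BddMeas f') (hle : ∀ x, f x ≤ f' x) :
    philt ν χ q g t f ≤ philt ν χ q g t f' := by
  rw [H.philt_eq t hf, H.philt_eq t hf']
  refine div_le_div_of_nonneg_right ?_ (H.init_mass_pos hχ t).le
  exact integral_mono (H.init_integrable t hf) (H.init_integrable t hf')
    fun x => mul_le_mul_of_nonneg_left (H.iterOp_mono 0 t hf hf' hle x) (H.g_nonneg 0 x)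

theorem philt_const (H : MixingModel ν q g σm σp cm) (hχ : cm ≤ ∫ x, g 0 x ∂χ) (t : ℕ) (c : ℝ) :
    philt ν χ q g t (fun _ => c) = c := by
  have h1 := H.philt_const_mul (χ := χ) t c (BddMeas.const 1)
  have h2 : philt ν χ q g t (fun _ => 1) = 1 := by
    rw [H.philt_eq t (BddMeas.const 1), div_self (H.init_mass_pos hχ t).ne']
  simpa [h2] using h1

/-- A function centred under the filter at time `r + n` is transported to time `r` with
geometrically small relative size. -/
theorem abs_iterOp_le_of_centred (H : MixingModel ν q g σm σp cm) (hχ : cm ≤ ∫ x, g 0 x ∂χ)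
    {f : X → ℝ} (hf : BddMeas f) {m₀ M₀ : ℝ} (hm₀ : ∀ x, m₀ ≤ f x) (hM₀ : ∀ x, f x ≤ M₀)
    (r n : ℕ) (hzero : philt ν χ q g (r + n) f = 0) (x : X) :
    |iterOp ν q g r n f x| ≤
      (1 - σm / σp) ^ n * (M₀ - m₀) * iterOp ν q g r n (fun _ => 1) x := by
  obtain ⟨m, M, hMm, hb⟩ := H.exists_iterOp_enclosure hf hm₀ hM₀ r n
  have hv : BddMeas (iterOp ν q g r n fun _ => 1) := H.iterOp_bdd r n (BddMeas.const 1)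
  have hu : BddMeas (iterOp ν q g r n f) := H.iterOp_bdd r n hf
  have hpos := H.init_mass_pos hχ (r + n)
  have hz : ∫ x, g 0 x * iterOp ν q g 0 (r + n) f x ∂χ = 0 := by
    rw [H.philt_eq _ hf, div_eq_zero_iff] at hzero
    exact hzero.resolve_right hpos.ne'
  rw [iterOp_add] at hz hpos
  rw [zero_add] at hz hpos
  have hm : m ≤ 0 := by
    refine nonpos_of_mul_nonpos_left ?_ hpos
    rw [← hz, ← integral_const_mul]
    refine integral_mono ((H.init_integrable r hv).const_mul _) (H.init_integrable r hu)
      fun y => ?_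
    have h1 := H.iterOp_mono 0 r ((BddMeas.const m).mul hv) hu (fun x => (hb x).1) y
    rw [iterOp_const_mul] at h1
    have := mul_le_mul_of_nonneg_left h1 (H.g_nonneg 0 y)
    simp only
    linarith
  have hM : 0 ≤ M := by
    refine nonneg_of_mul_nonneg_left ?_ hpos
    rw [← hz, ← integral_const_mul]
    refine integral_mono (H.init_integrable r hu) ((H.init_integrable r hv).const_mul _)
      fun y => ?_
    have h1 := H.iterOp_mono 0 r hu ((BddMeas.const M).mul hv) (fun x => (hb x).2) y
    rw [iterOp_const_mul] at h1
    have := mul_le_mul_of_nonneg_left h1 (H.g_nonneg 0 y)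
    simp only
    linarith
  have hv0 := (H.iterOp_one_pos r n x).le
  rw [← hMm, abs_le]
  have := hb x
  constructor <;> nlinarith

end Filtering

end MixingModel

theorem abs_sub_le_osc {Y : Type*} {f : Y → ℝ} (hf : ∃ K, ∀ x, |f x| ≤ K) (x y : Y) :
    |f x - f y| ≤ osc f := by
  obtain ⟨K, hK⟩ := hf
  refine le_ciSup (f := fun pr : Y × Y => |f pr.1 - f pr.2|) ⟨K + K, ?_⟩ (x, y)
  rintro _ ⟨pr, rfl⟩
  exact (abs_sub _ _).trans (add_le_add (hK _) (hK _))

theorem exists_enclosure_osc {Y : Type*} [Nonempty Y] {f : Y → ℝ} (hf : ∃ K, ∀ x, |f x| ≤ K) :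
    ∃ m M, M - m = osc f ∧ (∀ x, m ≤ f x) ∧ ∀ x, f x ≤ M := by
  have hosc := abs_sub_le_osc hf
  obtain ⟨K, hK⟩ := hf
  have hbdd : BddAbove (Set.range f) :=
    ⟨K, by rintro _ ⟨x, rfl⟩; exact (le_abs_self _).trans (hK x)⟩
  refine ⟨(⨆ x, f x) - osc f, ⨆ x, f x, by ring, fun x => ?_, le_ciSup hbdd⟩
  have : ⨆ y, f y ≤ f x + osc f :=
    ciSup_le fun y => by linarith [le_abs_self (f y - f x), hosc y x]
  linarith

theorem div_sq_le_of_le_mul {N w T e S P c : ℝ} (hN : N ≤ w * T * e * (S * P)) (hP : 0 < P)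
    (hwTe : 0 ≤ w * T * e) (hS : S ≤ c * P) : N / P ^ 2 ≤ w * T * e * c := by
  rw [div_le_iff₀ (by positivity)]
  calc N ≤ w * T * e * (S * P) := hN
    _ ≤ w * T * e * (c * P * P) := by gcongr
    _ = _ := by ring

namespace MixingModel

variable {ν χ : Measure X} [IsProbabilityMeasure χ] {q : X → X → ℝ} {g : ℕ → X → ℝ}
  {σm σp cm : ℝ}

theorem Vr_le (H : MixingModel ν q g σm σp cm) (hχ : cm ≤ ∫ x, g 0 x ∂χ)
    {ϑ : ℕ → X → ℝ} {p : ℕ → X → X → ℝ} {k n : ℕ} {w T E : ℝ}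
    (hϑm : Measurable (ϑ (k + 1))) (hϑ0 : ∀ x, 0 < ϑ (k + 1) x) (hϑT : ∀ x, ϑ (k + 1) x ≤ T)
    (hpm : Measurable fun pr : X × X => p (k + 1) pr.1 pr.2) (hp0 : ∀ x y, 0 < p (k + 1) x y)
    (hω : ∀ x y, omegaFn q g ϑ p (k + 1) x y ≤ w) {f : X → ℝ} (hf : BddMeas f)
    (hE : ∀ x, |iterOp ν q g (k + 1) n f x| ≤ E * iterOp ν q g (k + 1) n (fun _ => 1) x) :
    Vr ν χ q g ϑ p (k + 1) (k + 1 + n) f ≤ w * T * E ^ 2 * (σp / (cm * σm)) := by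
  have := H.prob
  obtain ⟨x₀⟩ := H.nonempty
  have hσm := H.lower_pos
  have hσp := H.upper_pos
  have hcm := H.charge_pos
  have hLf := fun x => H.Lop_eq_iterOp (k + 1) n hf x
  have hL1 := fun x => H.Lop_eq_iterOp (k + 1) n (BddMeas.const 1) x
  obtain ⟨S, hS0, hS⟩ := H.exists_iterOp_one_le (k + 1) n
  have hv0 := H.iterOp_one_pos (k + 1) n
  have hu : BddMeas (iterOp ν q g (k + 1) n f) := H.iterOp_bdd _ _ hf
  have hv : BddMeas (iterOp ν q g (k + 1) n fun _ => 1) := H.iterOp_bdd _ _ (BddMeas.const 1)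
  set u := iterOp ν q g (k + 1) n f
  set v := iterOp ν q g (k + 1) n fun _ => 1
  have hω0 : ∀ x y, 0 ≤ omegaFn q g ϑ p (k + 1) x y := fun x y =>
    div_nonneg (mul_nonneg (H.q_pos x y).le (H.g_nonneg _ y)) (mul_pos (hϑ0 x) (hp0 x y)).le
  have hw0 : 0 ≤ w := (hω0 x₀ x₀).trans (hω x₀ x₀)
  have hT0 : 0 ≤ T := (hϑ0 x₀).le.trans (hϑT x₀)
  have hϑb : BddMeas (ϑ (k + 1)) :=
    ⟨hϑm, T, fun x => by rw [abs_of_pos (hϑ0 x)]; exact hϑT x⟩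
  have hωb : BddMeas fun pr : X × X => omegaFn q g ϑ p (k + 1) pr.1 pr.2 :=
    ⟨(H.qg_bdd (k + 1)).1.div ((hϑm.comp measurable_fst).mul hpm), w, fun pr => by
      rw [abs_of_nonneg (hω0 _ _)]; exact hω _ _⟩
  have hF : BddMeas fun pr : X × X => omegaFn q g ϑ p (k + 1) pr.1 pr.2 *
      (q pr.1 pr.2 * g (k + 1) pr.2) * (u pr.2 * u pr.2) :=
    (hωb.mul (H.qg_bdd _)).mul ((hu.mul hu).comp measurable_snd)
  have hnum : (fun x => ϑ (k + 1) x * ∫ y, p (k + 1) x y * omegaFn q g ϑ p (k + 1) x y ^ 2 *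
      Lop ν q g (k + 1) (k + 1 + n) y f ^ 2 ∂ν) = fun x => ∫ y, omegaFn q g ϑ p (k + 1) x y *
      (q x y * g (k + 1) y) * (u y * u y) ∂ν := by
    funext x
    rw [← integral_const_mul]
    refine integral_congr_ae (Filter.Eventually.of_forall fun y => ?_)
    have h1 : ϑ (k + 1) x * p (k + 1) x y * omegaFn q g ϑ p (k + 1) x y = q x y * g (k + 1) y :=
      mul_div_cancel₀ _ (mul_pos (hϑ0 x) (hp0 x y)).ne'
    simp only [hLf, ← h1]
    ring
  have hden : phipred ν χ q g (k + 1)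
      (fun x => g (k + 1) x * Lop ν q g (k + 1) (k + 1 + n) x fun _ => 1) =
      philt ν χ q g k (stepOp ν q g (k + 1) v) := by
    simp only [phipred, hL1, Nat.add_sub_cancel, ← mul_assoc]
    rfl
  have hstep := H.stepOp_bdd (k + 1) hv
  set P := philt ν χ q g k (stepOp ν q g (k + 1) v)
  have hP : cm * (σm / σp * S) ≤ P := by
    rw [← H.philt_const hχ k (cm * (σm / σp * S))]
    exact H.philt_mono hχ k (BddMeas.const _) hstep fun x =>
      H.const_mul_le_stepOp (by omega) hv (by positivity) (fun y => (hS y).2) x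
  have hP0 : 0 < P := lt_of_lt_of_le (by positivity) hP
  have hN : philt ν χ q g k (fun x => ∫ y, omegaFn q g ϑ p (k + 1) x y *
      (q x y * g (k + 1) y) * (u y * u y) ∂ν) ≤ w * E ^ 2 * S * P := by
    rw [← H.philt_const_mul k _ hstep]
    refine H.philt_mono hχ k (hF.integral_prod_right ν) ((BddMeas.const _).mul hstep) fun x => ?_
    rw [stepOp, ← integral_const_mul]
    refine integral_mono ((hF.comp measurable_prodMk_left).integrable ν)
      (((H.step_integrand_bdd _ hv x).integrable ν).const_mul _) fun y => ?_
    have hu2 : u y * u y ≤ E ^ 2 * (S * v y) := by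
      have h1 : u y * u y ≤ (E * v y) ^ 2 := by
        rw [← sq, ← sq_abs]
        exact pow_le_pow_left₀ (abs_nonneg _) (hE y) 2
      have h2 := mul_le_mul_of_nonneg_left
        (mul_le_mul_of_nonneg_right (hS y).1 (hv0 y).le) (sq_nonneg E)
      linarith
    have hqg : 0 ≤ q x y * g (k + 1) y := mul_nonneg (H.q_pos x y).le (H.g_nonneg _ y)
    calc omegaFn q g ϑ p (k + 1) x y * (q x y * g (k + 1) y) * (u y * u y)
        ≤ w * (q x y * g (k + 1) y) * (E ^ 2 * (S * v y)) :=
          mul_le_mul (mul_le_mul_of_nonneg_right (hω x y) hqg) hu2 (mul_self_nonneg _)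
            (mul_nonneg hw0 hqg)
      _ = _ := by ring
  have hϑT' : philt ν χ q g k (ϑ (k + 1)) ≤ T := by
    rw [← H.philt_const hχ k T]
    exact H.philt_mono hχ k hϑb (BddMeas.const T) hϑT
  have hϑ0' : 0 ≤ philt ν χ q g k (ϑ (k + 1)) := by
    rw [← H.philt_const hχ k 0]
    exact H.philt_mono hχ k (BddMeas.const 0) hϑb fun x => (hϑ0 x).le
  rw [Vr, hden, hnum, Nat.add_sub_cancel]
  refine div_sq_le_of_le_mul (S := S) ?_ hP0 (by positivity) ?_
  · refine (mul_le_mul hN hϑT' hϑ0' (by positivity)).trans_eq ?_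
    ring
  · rw [div_mul_eq_mul_div, le_div_iff₀ (by positivity)]
    have h1 := mul_le_mul_of_nonneg_left hP hσp.le
    have h2 : σp * (cm * (σm / σp * S)) = S * (cm * σm) := by field_simp
    linarith

theorem V0_le (H : MixingModel ν q g σm σp cm) (hχ : cm ≤ ∫ x, g 0 x ∂χ)
    {ρ₀ : Measure X} [IsProbabilityMeasure ρ₀] {d0 : X → ℝ} (hdm : Measurable d0)
    (hd0 : ∀ x, 0 ≤ d0 x) (hac : χ = ρ₀.withDensity fun x => ENNReal.ofReal (d0 x)) {n : ℕ}
    {w E : ℝ} (hω : ∀ x, |d0 x * g 0 x| ≤ w) {f : X → ℝ} (hf : BddMeas f)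
    (hE : ∀ x, |iterOp ν q g 0 n f x| ≤ E * iterOp ν q g 0 n (fun _ => 1) x) :
    V0 ν ρ₀ χ q g d0 n f ≤ w * E ^ 2 * (σp / (cm * σm)) := by
  obtain ⟨x₀⟩ := H.nonempty
  have hσm := H.lower_pos
  have hσp := H.upper_pos
  have hcm := H.charge_pos
  have hLf := fun x => H.Lop_eq_iterOp 0 n hf x
  have hL1 := fun x => H.Lop_eq_iterOp 0 n (BddMeas.const 1) x
  simp only [zero_add] at hLf hL1
  obtain ⟨S, hS0, hS⟩ := H.exists_iterOp_one_le 0 n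
  have hP0 := H.init_mass_pos hχ n
  have hint := H.init_integrable (χ := χ) n (BddMeas.const 1)
  have hv0 := H.iterOp_one_pos 0 n
  have hu : BddMeas (iterOp ν q g 0 n f) := H.iterOp_bdd _ _ hf
  have hv : BddMeas (iterOp ν q g 0 n fun _ => 1) := H.iterOp_bdd _ _ (BddMeas.const 1)
  have hw0 : 0 ≤ w := (abs_nonneg _).trans (hω x₀)
  have hω0 : ∀ x, 0 ≤ d0 x * g 0 x := fun x => mul_nonneg (hd0 x) (H.g_nonneg 0 x)
  have hωb : BddMeas fun x => d0 x * g 0 x := ⟨hdm.mul (H.g_bdd 0).1, w, hω⟩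
  simp only [V0, hLf, hL1]
  set u := iterOp ν q g 0 n f
  set v := iterOp ν q g 0 n fun _ => 1
  have hdens : ∫ x, g 0 x * v x ∂χ = ∫ x, d0 x * g 0 x * v x ∂ρ₀ := by
    rw [hac, integral_withDensity_eq_integral_toReal_smul hdm.ennreal_ofReal
      (Filter.Eventually.of_forall fun x => ENNReal.ofReal_lt_top)]
    refine integral_congr_ae (Filter.Eventually.of_forall fun x => ?_)
    simp only [ENNReal.toReal_ofReal (hd0 x), smul_eq_mul, mul_assoc]
  set P := ∫ x, g 0 x * v x ∂χ
  have hP : cm * (σm / σp * S) ≤ P := by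
    have h1 : (∫ x, g 0 x ∂χ) * (σm / σp * S) ≤ P := by
      rw [← integral_mul_const]
      exact integral_mono (((H.g_bdd 0).integrable χ).mul_const _) hint
        fun x => mul_le_mul_of_nonneg_left (hS x).2 (H.g_nonneg 0 x)
    exact (mul_le_mul_of_nonneg_right hχ (by positivity)).trans h1
  have hN : ∫ x, (d0 x * g 0 x) ^ 2 * u x ^ 2 ∂ρ₀ ≤ w * E ^ 2 * S * P := by
    rw [hdens, ← integral_const_mul]
    have hb : BddMeas fun x => (d0 x * g 0 x) ^ 2 * u x ^ 2 := by
      simp only [sq]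
      exact (hωb.mul hωb).mul (hu.mul hu)
    refine integral_mono (hb.integrable ρ₀) (((hωb.mul hv).integrable ρ₀).const_mul _) fun x => ?_
    have hu2 : u x ^ 2 ≤ E ^ 2 * (S * v x) := by
      have h1 : u x ^ 2 ≤ (E * v x) ^ 2 := by
        rw [← sq_abs]
        exact pow_le_pow_left₀ (abs_nonneg _) (hE x) 2
      have h2 := mul_le_mul_of_nonneg_left
        (mul_le_mul_of_nonneg_right (hS x).1 (hv0 x).le) (sq_nonneg E)
      linarith
    have hωw : d0 x * g 0 x ≤ w := (le_abs_self _).trans (hω x)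
    calc (d0 x * g 0 x) ^ 2 * u x ^ 2
        ≤ (w * (d0 x * g 0 x)) * (E ^ 2 * (S * v x)) := by
          rw [sq (d0 x * g 0 x)]
          exact mul_le_mul (mul_le_mul_of_nonneg_right hωw (hω0 x)) hu2 (sq_nonneg _)
            (mul_nonneg hw0 (hω0 x))
      _ = _ := by ring
  have hSP : S ≤ σp / (cm * σm) * P := by
    rw [div_mul_eq_mul_div, le_div_iff₀ (by positivity)]
    have h1 := mul_le_mul_of_nonneg_left hP hσp.le
    have h2 : σp * (cm * (σm / σp * S)) = S * (cm * σm) := by field_simp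
    linarith
  simpa using div_sq_le_of_le_mul (T := 1) (hN.trans_eq (by ring)) hP0 (by positivity) hSP

end MixingModel

theorem sum_range_pow_sub_le {ρ : ℝ} (h0 : 0 ≤ ρ) (h1 : ρ < 1) (s : ℕ) :
    ∑ r ∈ Finset.range (s + 1), (ρ ^ (s - r)) ^ 2 ≤ 1 / (1 - ρ ^ 2) := by
  have hlt : ρ ^ 2 < 1 := pow_lt_one₀ h0 h1 two_ne_zero
  have hrefl : ∑ r ∈ Finset.range (s + 1), (ρ ^ (s - r)) ^ 2
      = ∑ j ∈ Finset.range (s + 1), (ρ ^ 2) ^ j := by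
    rw [← Finset.sum_range_reflect]
    refine Finset.sum_congr rfl fun r hr => ?_
    rw [← pow_mul, ← pow_mul, mul_comm]
    congr 2
    have := Finset.mem_range.1 hr
    omega
  rw [hrefl, le_div_iff₀ (by linarith), geom_sum_mul_neg]
  have : 0 ≤ (ρ ^ 2) ^ (s + 1) := by positivity
  linarith

end FilterStability

theorem stmt_10 {X : Type*} [MeasurableSpace X] (ν : Measure X) (hν : ν Set.univ = 1)
    (σm σp cm : ℝ) (hσm : 0 < σm) (hσmp : σm ≤ σp) (hcm : 0 < cm)
    (q : X → X → ℝ) (hqmeas : Measurable fun pr : X × X => q pr.1 pr.2)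
    (hq : ∀ x y, σm ≤ q x y ∧ q x y ≤ σp)
    (χ : Measure X) [IsProbabilityMeasure χ]
    (g : ℕ → X → ℝ) (hgmeas : ∀ t, Measurable (g t))
    (hg0 : ∀ t x, 0 ≤ g t x) (hgb : ∃ K, ∀ t x, g t x ≤ K)
    (hχg0 : cm ≤ ∫ x, g 0 x ∂χ)
    (hqg : ∀ t, 1 ≤ t → ∀ x, cm ≤ ∫ y, q x y * g t y ∂ν)
    (ϑ : ℕ → X → ℝ) (hϑmeas : ∀ t, Measurable (ϑ t))
    (hϑpos : ∀ t, 1 ≤ t → ∀ x, 0 < ϑ t x)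
    (hϑb : ∃ K, ∀ t, 1 ≤ t → ∀ x, ϑ t x ≤ K)
    (p : ℕ → X → X → ℝ) (hpmeas : ∀ t, Measurable fun pr : X × X => p t pr.1 pr.2)
    (hppos : ∀ t, 1 ≤ t → ∀ x y, 0 < p t x y)
    (hpint : ∀ t, 1 ≤ t → ∀ x, ∫ y, p t x y ∂ν = 1)
    (hωb : ∃ K, ∀ t, 1 ≤ t → ∀ x y, omegaFn q g ϑ p t x y ≤ K)
    (ρ₀ : Measure X) [IsProbabilityMeasure ρ₀]
    (d0 : X → ℝ) (hd0meas : Measurable d0) (hd00 : ∀ x, 0 ≤ d0 x)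
    (hac : χ = ρ₀.withDensity fun x => ENNReal.ofReal (d0 x))
    (hw0b : ∃ K, ∀ x, |d0 x * g 0 x| ≤ K)
    (s : ℕ) (hs : 1 ≤ s)
    (h : X → ℝ) (hhm : Measurable h) (hhb : ∃ K, ∀ x, |h x| ≤ K)
    (hzero : philt ν χ q g s h = 0) :
    ∑ r ∈ Finset.range (s + 1), Vrs ν ρ₀ χ q g d0 ϑ p r s h ≤
      (σp / (cm * σm)) *
        (⨆ r : ℕ, supOmega q g d0 ϑ p r * supTheta ϑ r) *
        osc h ^ 2 / (1 - (1 - σm / σp) ^ 2) := by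
  obtain ⟨Kg, hKg⟩ := hgb
  obtain ⟨Kϑ, hKϑ⟩ := hϑb
  obtain ⟨Kω, hKω⟩ := hωb
  obtain ⟨Kw, hKw⟩ := hw0b
  have H : MixingModel ν q g σm σp cm :=
    { prob := ⟨hν⟩
      lower_pos := hσm
      charge_pos := hcm
      q_measurable := hqmeas
      lower_le := fun x y => (hq x y).1
      le_upper := fun x y => (hq x y).2
      g_bdd := fun t => ⟨hgmeas t, Kg, fun x => by rw [abs_of_nonneg (hg0 t x)]; exact hKg t x⟩
      g_nonneg := hg0
      charge := hqg }
  have hne := H.nonempty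
  have hσp := H.upper_pos
  have hf : BddMeas h := ⟨hhm, hhb⟩
  obtain ⟨m₀, M₀, hosc, hm₀, hM₀⟩ := exists_enclosure_osc hhb
  have hω0 : ∀ t, 1 ≤ t → ∀ x y, 0 ≤ omegaFn q g ϑ p t x y := fun t ht x y =>
    div_nonneg (mul_nonneg (H.q_pos x y).le (hg0 t y)) (mul_pos (hϑpos t ht x) (hppos t ht x y)).le
  have hωabs : ∀ t, 1 ≤ t → ∀ pr : X × X, |omegaFn q g ϑ p t pr.1 pr.2| ≤ Kω := fun t ht pr => by
    rw [abs_of_nonneg (hω0 t ht _ _)]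
    exact hKω t ht _ _
  have hϑabs : ∀ t, 1 ≤ t → ∀ x, |ϑ t x| ≤ Kϑ := fun t ht x => by
    rw [abs_of_pos (hϑpos t ht x)]
    exact hKϑ t ht x
  have hsω0 : ∀ r, 0 ≤ supOmega q g d0 ϑ p r := fun r => by
    unfold supOmega
    split_ifs <;> exact Real.iSup_nonneg fun _ => abs_nonneg _
  have hsϑ0 : ∀ r, 0 ≤ supTheta ϑ r := fun r => by
    unfold supTheta
    split_ifs
    · exact zero_le_one
    · exact Real.iSup_nonneg fun _ => abs_nonneg _
  have hsω : ∀ r, supOmega q g d0 ϑ p r ≤ max Kw Kω := fun r => by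
    unfold supOmega
    split_ifs with hr
    · exact (ciSup_le hKw).trans (le_max_left _ _)
    · exact (ciSup_le (hωabs r (by omega))).trans (le_max_right _ _)
  have hsϑ : ∀ r, supTheta ϑ r ≤ max 1 Kϑ := fun r => by
    unfold supTheta
    split_ifs with hr
    · exact le_max_left _ _
    · exact (ciSup_le (hϑabs r (by omega))).trans (le_max_right _ _)
  have hbdd : BddAbove (Set.range fun r : ℕ => supOmega q g d0 ϑ p r * supTheta ϑ r) := by
    refine ⟨max Kw Kω * max 1 Kϑ, ?_⟩
    rintro _ ⟨r, rfl⟩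
    exact mul_le_mul (hsω r) (hsϑ r) (hsϑ0 r) ((hsω0 r).trans (hsω r))
  have hle := le_ciSup hbdd
  set A := ⨆ r : ℕ, supOmega q g d0 ϑ p r * supTheta ϑ r
  have hA0 : 0 ≤ A := (mul_nonneg (hsω0 0) (hsϑ0 0)).trans (hle 0)
  set ρ := 1 - σm / σp with hρ
  have hρ0 : 0 ≤ ρ := sub_nonneg.2 ((div_le_one hσp).2 hσmp)
  have hρ1 : ρ < 1 := sub_lt_self _ (div_pos hσm hσp)
  have hterm : ∀ r ∈ Finset.range (s + 1), Vrs ν ρ₀ χ q g d0 ϑ p r s h ≤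
      A * osc h ^ 2 * (σp / (cm * σm)) * (ρ ^ (s - r)) ^ 2 := by
    intro r hr
    obtain ⟨n, rfl⟩ := Nat.exists_eq_add_of_le (Nat.lt_succ_iff.1 (Finset.mem_range.1 hr))
    have hE := H.abs_iterOp_le_of_centred hχg0 hf hm₀ hM₀ r n hzero
    rw [hosc, ← hρ] at hE
    have hV : Vrs ν ρ₀ χ q g d0 ϑ p r (r + n) h ≤
        supOmega q g d0 ϑ p r * supTheta ϑ r * (ρ ^ n * osc h) ^ 2 * (σp / (cm * σm)) := by
      cases r with
      | zero =>
        have hω : ∀ x, |d0 x * g 0 x| ≤ supOmega q g d0 ϑ p 0 :=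
          le_ciSup (f := fun x => |d0 x * g 0 x|)
            ⟨Kw, by rintro _ ⟨x, rfl⟩; exact hKw x⟩
        have := H.V0_le hχg0 hd0meas hd00 hac hω hf hE
        simpa [Vrs, supTheta] using this
      | succ k =>
        have hω : ∀ x y, omegaFn q g ϑ p (k + 1) x y ≤ supOmega q g d0 ϑ p (k + 1) := fun x y =>
          (le_abs_self _).trans
            (le_ciSup (f := fun pr : X × X => |omegaFn q g ϑ p (k + 1) pr.1 pr.2|)
              ⟨Kω, by rintro _ ⟨pr, rfl⟩; exact hωabs _ (by omega) pr⟩ (x, y))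
        have hϑ : ∀ x, ϑ (k + 1) x ≤ supTheta ϑ (k + 1) := fun x =>
          (le_abs_self _).trans (le_ciSup (f := fun x => |ϑ (k + 1) x|)
            ⟨Kϑ, by rintro _ ⟨x, rfl⟩; exact hϑabs _ (by omega) x⟩ x)
        rw [Vrs, if_neg (by omega)]
        exact H.Vr_le hχg0 (hϑmeas _) (hϑpos _ (by omega)) hϑ (hpmeas _) (hppos _ (by omega))
          hω hf hE
    refine hV.trans ?_
    rw [Nat.add_sub_cancel_left]
    calc supOmega q g d0 ϑ p r * supTheta ϑ r * (ρ ^ n * osc h) ^ 2 * (σp / (cm * σm))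
        ≤ A * (ρ ^ n * osc h) ^ 2 * (σp / (cm * σm)) := by
          gcongr
          exact hle r
      _ = _ := by ring
  refine (Finset.sum_le_sum hterm).trans ?_
  rw [← Finset.mul_sum]
  refine (mul_le_mul_of_nonneg_left (sum_range_pow_sub_le hρ0 hρ1 s) (by positivity)).trans_eq ?_
  ring
end

section
/- For every integer s ≥ 1 and every bounded measurable function h : X → ℝ with φ_{s|s}(h) = 0, V_{χ,0,s}[h] ≤ (‖ω₀‖_∞/c₋)·(σ₊/σ₋)·ρ^{2s}·osc(h)². -/
open MeasureTheory

/-- Measurable real functions with bounded absolute value. -/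
def BddMeasurable {Y : Type*} [MeasurableSpace Y] (f : Y → ℝ) : Prop :=
  Measurable f ∧ ∃ K, ∀ y, |f y| ≤ K

namespace BddMeasurable

variable {Y Z : Type*} [MeasurableSpace Y] [MeasurableSpace Z] {f f' : Y → ℝ}

theorem const (c : ℝ) : BddMeasurable fun _ : Y => c :=
  ⟨measurable_const, |c|, fun _ => le_rfl⟩

theorem mul (hf : BddMeasurable f) (hf' : BddMeasurable f') :
    BddMeasurable fun y => f y * f' y := by
  obtain ⟨hm, K, hK⟩ := hf
  obtain ⟨hm', K', hK'⟩ := hf'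
  refine ⟨hm.mul hm', K * K', fun y => ?_⟩
  rw [abs_mul]
  exact mul_le_mul (hK y) (hK' y) (abs_nonneg _) ((abs_nonneg _).trans (hK y))

theorem sub (hf : BddMeasurable f) (hf' : BddMeasurable f') :
    BddMeasurable fun y => f y - f' y := by
  obtain ⟨hm, K, hK⟩ := hf
  obtain ⟨hm', K', hK'⟩ := hf'
  exact ⟨hm.sub hm', K + K', fun y => (abs_sub _ _).trans (add_le_add (hK y) (hK' y))⟩

theorem comp (hf : BddMeasurable f) {e : Z → Y} (he : Measurable e) :
    BddMeasurable fun z => f (e z) := by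
  obtain ⟨hm, K, hK⟩ := hf
  exact ⟨hm.comp he, K, fun z => hK _⟩

theorem integrable (hf : BddMeasurable f) (μ : Measure Y) [IsFiniteMeasure μ] :
    Integrable f μ := by
  obtain ⟨hm, K, hK⟩ := hf
  exact Integrable.of_bound hm.aestronglyMeasurable K (ae_of_all _ hK)

theorem integral_prod {F : Z × Y → ℝ} (hF : BddMeasurable F) (μ : Measure Y)
    [IsProbabilityMeasure μ] : BddMeasurable fun z => ∫ y, F (z, y) ∂μ := by
  obtain ⟨hm, K, hK⟩ := hF
  refine ⟨hm.stronglyMeasurable.integral_prod_right'.measurable, K, fun z => ?_⟩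
  have := norm_integral_le_of_norm_le_const (μ := μ) (f := fun y => F (z, y)) (C := K)
    (ae_of_all _ fun y => hK (z, y))
  simpa using this

end BddMeasurable

theorem le_iInf_add_osc {Y : Type*} {h : Y → ℝ} (hb : ∃ K, ∀ y, |h y| ≤ K) (y : Y) :
    (⨅ z, h z) ≤ h y ∧ h y ≤ (⨅ z, h z) + osc h := by
  obtain ⟨K, hK⟩ := hb
  have : Nonempty Y := ⟨y⟩
  refine ⟨ciInf_le ⟨-K, ?_⟩ y, ?_⟩
  · rintro _ ⟨z, rfl⟩
    exact (abs_le.1 (hK z)).1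
  · have : h y - osc h ≤ ⨅ z, h z := by
      refine le_ciInf fun z => ?_
      have hbd : BddAbove (Set.range fun pr : Y × Y => |h pr.1 - h pr.2|) := by
        refine ⟨K + K, ?_⟩
        rintro _ ⟨pr, rfl⟩
        exact (abs_sub _ _).trans (add_le_add (hK _) (hK _))
      have h1 : |h y - h z| ≤ osc h := le_ciSup hbd (y, z)
      linarith [le_abs_self (h y - h z)]
    linarith

section Kernel

variable {X : Type*} [MeasurableSpace X] {ν : Measure X} [IsProbabilityMeasure ν]
  {q : X → X → ℝ} {g : ℕ → X → ℝ}

theorem bddMeasurable_transition (hq : BddMeasurable fun p : X × X => q p.1 p.2)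
    {γ f : X → ℝ} (hγ : BddMeasurable γ) (hf : BddMeasurable f) :
    BddMeasurable fun x => ∫ y, q x y * γ y * f y ∂ν :=
  BddMeasurable.integral_prod (F := fun p : X × X => q p.1 p.2 * γ p.2 * f p.2)
    ((hq.mul (hγ.comp measurable_snd)).mul (hf.comp measurable_snd)) ν

theorem bddMeasurable_ell (hq : BddMeasurable fun p : X × X => q p.1 p.2)
    (hg : ∀ t, BddMeasurable (g t)) (s n : ℕ) :
    BddMeasurable fun p : X × X => ell ν q g s n p.1 p.2 := by
  induction n with
  | zero => exact hq.mul ((hg _).comp measurable_snd)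
  | succ n ih =>
    refine BddMeasurable.integral_prod (F := fun p : (X × X) × X =>
      ell ν q g s n p.1.1 p.2 * (q p.2 p.1.2 * g (s + n + 2) p.1.2)) ?_ ν
    exact (ih.comp (e := fun p : (X × X) × X => (p.1.1, p.2)) (by fun_prop)).mul
      ((hq.comp (e := fun p : (X × X) × X => (p.2, p.1.2)) (by fun_prop)).mul
        ((hg _).comp (e := fun p : (X × X) × X => p.1.2) (by fun_prop)))

theorem integral_ell_succ (hq : BddMeasurable fun p : X × X => q p.1 p.2)
    (hg : ∀ t, BddMeasurable (g t)) (s n : ℕ) (x : X) {f : X → ℝ} (hf : BddMeasurable f) :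
    ∫ y, ell ν q g s (n + 1) x y * f y ∂ν =
      ∫ z, ell ν q g s n x z * ∫ y, q z y * g (s + n + 2) y * f y ∂ν ∂ν := by
  have hF : BddMeasurable fun p : X × X =>
      ell ν q g s n x p.2 * (q p.2 p.1 * g (s + n + 2) p.1) * f p.1 :=
    (((bddMeasurable_ell hq hg s n).comp (e := fun p : X × X => (x, p.2)) (by fun_prop)).mul
      ((hq.comp (e := fun p : X × X => (p.2, p.1)) (by fun_prop)).mul
        ((hg _).comp measurable_fst))).mul (hf.comp measurable_fst)
  calc ∫ y, ell ν q g s (n + 1) x y * f y ∂ν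
      = ∫ y, ∫ z, ell ν q g s n x z * (q z y * g (s + n + 2) y) * f y ∂ν ∂ν := by
        simp only [ell, integral_mul_const]
    _ = ∫ z, ∫ y, ell ν q g s n x z * (q z y * g (s + n + 2) y) * f y ∂ν ∂ν :=
        integral_integral_swap (hF.integrable _)
    _ = _ := by simp only [mul_assoc, integral_const_mul]

variable {σm σp : ℝ}

theorem mul_ell_le_mul_ell (hq : BddMeasurable fun p : X × X => q p.1 p.2)
    (hg : ∀ t, BddMeasurable (g t)) (hσm : 0 < σm) (hqb : ∀ x y, σm ≤ q x y ∧ q x y ≤ σp)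
    (hg0 : ∀ t x, 0 ≤ g t x) (s n : ℕ) (x x' y : X) :
    σm * ell ν q g s n x y ≤ σp * ell ν q g s n x' y := by
  have hσp : 0 < σp := hσm.trans_le ((hqb x x).1.trans (hqb x x).2)
  induction n generalizing y with
  | zero =>
    simp only [ell, ← mul_assoc]
    refine mul_le_mul_of_nonneg_right ?_ (hg0 _ _)
    nlinarith [hqb x y, hqb x' y]
  | succ n ih =>
    simp only [ell, ← integral_const_mul]
    have hint : ∀ a, Integrable (fun z => ell ν q g s n a z * (q z y * g (s + n + 2) y)) ν :=
      fun a => (((bddMeasurable_ell hq hg s n).comp (e := fun z => (a, z)) (by fun_prop)).mul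
        ((hq.comp (e := fun z => (z, y)) (by fun_prop)).mul (.const _))).integrable ν
    refine integral_mono ((hint x).const_mul _) ((hint x').const_mul _) fun z => ?_
    simp only [← mul_assoc]
    exact mul_le_mul_of_nonneg_right
      (mul_le_mul_of_nonneg_right (ih z) (hσm.le.trans (hqb z y).1)) (hg0 _ _)

theorem transition_le (hq : BddMeasurable fun p : X × X => q p.1 p.2)
    (hqb : ∀ x y, σm ≤ q x y ∧ q x y ≤ σp)
    {γ w : X → ℝ} (hγ : BddMeasurable γ) (hγ0 : ∀ x, 0 ≤ γ x)
    (hw : BddMeasurable w) (hw0 : ∀ x, 0 ≤ w x) (x : X) :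
    ∫ y, q x y * γ y * w y ∂ν ≤ σp * ∫ y, γ y * w y ∂ν := by
  have hqx : BddMeasurable fun y => q x y := hq.comp (e := fun y => (x, y)) (by fun_prop)
  rw [← integral_const_mul]
  refine integral_mono (((hqx.mul hγ).mul hw).integrable ν)
    (((hγ.mul hw).integrable ν).const_mul _) fun y => ?_
  simp only [mul_assoc]
  exact mul_le_mul_of_nonneg_right (hqb x y).2 (mul_nonneg (hγ0 y) (hw0 y))

/-- Integrating `u ≥ 0` against the transition from any point dominates the share `σm / σp` of
the mass `∫ γ u / ∫ γ w` of the integral of `w`. -/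
theorem transition_minorization (hq : BddMeasurable fun p : X × X => q p.1 p.2)
    (hσm : 0 < σm) (hqb : ∀ x y, σm ≤ q x y ∧ q x y ≤ σp)
    {γ u w : X → ℝ} (hγ : BddMeasurable γ) (hγ0 : ∀ x, 0 ≤ γ x)
    (hu : BddMeasurable u) (hu0 : ∀ x, 0 ≤ u x) (hw : BddMeasurable w) (hw0 : ∀ x, 0 ≤ w x)
    (hpos : 0 < ∫ y, γ y * w y ∂ν) (x : X) :
    σm / σp * ((∫ y, γ y * u y ∂ν) / ∫ y, γ y * w y ∂ν) * ∫ y, q x y * γ y * w y ∂ν ≤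
      ∫ y, q x y * γ y * u y ∂ν := by
  have hσp : 0 < σp := hσm.trans_le ((hqb x x).1.trans (hqb x x).2)
  have hqx : BddMeasurable fun y => q x y := hq.comp (e := fun y => (x, y)) (by fun_prop)
  have hlow : σm * ∫ y, γ y * u y ∂ν ≤ ∫ y, q x y * γ y * u y ∂ν := by
    rw [← integral_const_mul]
    refine integral_mono (((hγ.mul hu).integrable ν).const_mul _)
      (((hqx.mul hγ).mul hu).integrable ν) fun y => ?_
    simp only [mul_assoc]
    exact mul_le_mul_of_nonneg_right (hqb x y).1 (mul_nonneg (hγ0 y) (hu0 y))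
  have hup := transition_le hq hqb hγ hγ0 hw hw0 x (ν := ν)
  have hu' : 0 ≤ ∫ y, γ y * u y ∂ν := integral_nonneg fun y => mul_nonneg (hγ0 y) (hu0 y)
  refine le_trans (mul_le_mul_of_nonneg_left hup (by positivity)) (le_trans (le_of_eq ?_) hlow)
  field_simp

/-- One transition contracts the interval enclosing the ratio `h / w` by `1 - σm / σp`. -/
theorem transition_contraction (hq : BddMeasurable fun p : X × X => q p.1 p.2)
    (hσm : 0 < σm) (hqb : ∀ x y, σm ≤ q x y ∧ q x y ≤ σp)
    {γ h w : X → ℝ} (hγ : BddMeasurable γ) (hγ0 : ∀ x, 0 ≤ γ x)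
    (hh : BddMeasurable h) (hw : BddMeasurable w) (hw0 : ∀ x, 0 ≤ w x)
    (hpos : 0 < ∫ y, γ y * w y ∂ν) {a b : ℝ} (hab : ∀ x, a * w x ≤ h x ∧ h x ≤ b * w x) :
    ∃ a' b', b' - a' = (1 - σm / σp) * (b - a) ∧
      ∀ x, a' * (∫ y, q x y * γ y * w y ∂ν) ≤ ∫ y, q x y * γ y * h y ∂ν ∧
        ∫ y, q x y * γ y * h y ∂ν ≤ b' * ∫ y, q x y * γ y * w y ∂ν := by
  set I := ∫ y, γ y * w y ∂ν with hI
  set J := ∫ y, γ y * h y ∂ν with hJ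
  have hiw := (hγ.mul hw).integrable ν
  have hih := (hγ.mul hh).integrable ν
  have hu : BddMeasurable fun x => h x - a * w x := hh.sub ((BddMeasurable.const a).mul hw)
  have hv : BddMeasurable fun x => b * w x - h x := ((BddMeasurable.const b).mul hw).sub hh
  have hJu : ∫ y, γ y * (h y - a * w y) ∂ν = J - a * I := by
    rw [hI, hJ, ← integral_const_mul, ← integral_sub hih (hiw.const_mul a)]
    congr 1 with y
    ring
  have hJv : ∫ y, γ y * (b * w y - h y) ∂ν = b * I - J := by
    rw [hI, hJ, ← integral_const_mul, ← integral_sub (hiw.const_mul b) hih]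
    congr 1 with y
    ring
  refine ⟨a + σm / σp * ((J - a * I) / I), b - σm / σp * ((b * I - J) / I), ?_, fun x => ?_⟩
  · field_simp
    ring
  have hqx : BddMeasurable fun y => q x y := hq.comp (e := fun y => (x, y)) (by fun_prop)
  have hiqw := ((hqx.mul hγ).mul hw).integrable ν
  have hiqh := ((hqx.mul hγ).mul hh).integrable ν
  have h1 := transition_minorization hq hσm hqb hγ hγ0 hu (fun x => sub_nonneg.2 (hab x).1)
    hw hw0 hpos x
  have h2 := transition_minorization hq hσm hqb hγ hγ0 hv (fun x => sub_nonneg.2 (hab x).2)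
    hw hw0 hpos x
  rw [hJu] at h1
  rw [hJv] at h2
  have e1 : ∫ y, q x y * γ y * (h y - a * w y) ∂ν =
      ∫ y, q x y * γ y * h y ∂ν - a * ∫ y, q x y * γ y * w y ∂ν := by
    rw [← integral_const_mul, ← integral_sub hiqh (hiqw.const_mul a)]
    congr 1 with y
    ring
  have e2 : ∫ y, q x y * γ y * (b * w y - h y) ∂ν =
      b * ∫ y, q x y * γ y * w y ∂ν - ∫ y, q x y * γ y * h y ∂ν := by
    rw [← integral_const_mul, ← integral_sub (hiqw.const_mul b) hiqh]
    congr 1 with y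
    ring
  rw [e1] at h1
  rw [e2] at h2
  constructor <;> linarith

theorem mul_le_transition (hq : BddMeasurable fun p : X × X => q p.1 p.2)
    (hqb : ∀ x y, 0 ≤ q x y) {γ w : X → ℝ} (hγ : BddMeasurable γ) (hγ0 : ∀ x, 0 ≤ γ x)
    (hw : BddMeasurable w) {ε c : ℝ} (hε : 0 ≤ ε) (hεw : ∀ x, ε ≤ w x) {x : X}
    (hc : c ≤ ∫ y, q x y * γ y ∂ν) : ε * c ≤ ∫ y, q x y * γ y * w y ∂ν := by
  have hqx : BddMeasurable fun y => q x y := hq.comp (e := fun y => (x, y)) (by fun_prop)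
  refine (mul_le_mul_of_nonneg_left hc hε).trans ?_
  rw [← integral_const_mul]
  refine integral_mono (((hqx.mul hγ).integrable ν).const_mul _)
    (((hqx.mul hγ).mul hw).integrable ν) fun y => ?_
  rw [mul_comm ε]
  exact mul_le_mul_of_nonneg_left (hεw y) (mul_nonneg (hqb x y) (hγ0 y))

theorem integral_mul_pos (hq : BddMeasurable fun p : X × X => q p.1 p.2)
    (hσm : 0 < σm) (hqb : ∀ x y, σm ≤ q x y ∧ q x y ≤ σp)
    {γ w : X → ℝ} (hγ : BddMeasurable γ) (hγ0 : ∀ x, 0 ≤ γ x)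
    (hw : BddMeasurable w) {ε c : ℝ} (hε : 0 < ε) (hεw : ∀ x, ε ≤ w x) (hc : 0 < c)
    (hqγ : ∀ x, c ≤ ∫ y, q x y * γ y ∂ν) : 0 < ∫ y, γ y * w y ∂ν := by
  obtain ⟨x⟩ : Nonempty X := nonempty_of_isProbabilityMeasure ν
  have hσp : 0 < σp := hσm.trans_le ((hqb x x).1.trans (hqb x x).2)
  have h1 : ε * c ≤ ∫ y, q x y * γ y * w y ∂ν :=
    mul_le_transition hq (fun x y => hσm.le.trans (hqb x y).1) hγ hγ0 hw hε.le hεw (hqγ x)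
  have h2 := transition_le hq hqb hγ hγ0 hw (fun x => hε.le.trans (hεw x)) x (ν := ν)
  exact pos_of_mul_pos_right ((mul_pos hε hc).trans_le (h1.trans h2)) hσp.le

variable {c : ℝ}

theorem mul_pow_le_integral_ell (hq : BddMeasurable fun p : X × X => q p.1 p.2)
    (hg : ∀ t, BddMeasurable (g t)) (hqb : ∀ x y, 0 ≤ q x y) (hg0 : ∀ t x, 0 ≤ g t x)
    (hc : 0 ≤ c) (hqg : ∀ t, 1 ≤ t → ∀ x, c ≤ ∫ y, q x y * g t y ∂ν) (s n : ℕ)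
    {w : X → ℝ} (hw : BddMeasurable w) {ε : ℝ} (hε : 0 ≤ ε) (hεw : ∀ x, ε ≤ w x) (x : X) :
    ε * c ^ (n + 1) ≤ ∫ y, ell ν q g s n x y * w y ∂ν := by
  induction n generalizing w ε with
  | zero =>
    simpa [ell] using
      mul_le_transition hq hqb (hg (s + 1)) (hg0 _) hw hε hεw (hqg _ (by omega) x)
  | succ n ih =>
    rw [integral_ell_succ hq hg s n x hw, pow_succ', ← mul_assoc]
    exact ih (bddMeasurable_transition hq (hg _) hw) (mul_nonneg hε hc) fun z =>
      mul_le_transition hq hqb (hg _) (hg0 _) hw hε hεw (hqg _ (by omega) z)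

/-- The `n + 1`-step kernel contracts the interval enclosing the ratio `h / w` by
`(1 - σm / σp) ^ (n + 1)`. -/
theorem ell_contraction (hq : BddMeasurable fun p : X × X => q p.1 p.2)
    (hg : ∀ t, BddMeasurable (g t)) (hσm : 0 < σm) (hqb : ∀ x y, σm ≤ q x y ∧ q x y ≤ σp)
    (hg0 : ∀ t x, 0 ≤ g t x) (hc : 0 < c) (hqg : ∀ t, 1 ≤ t → ∀ x, c ≤ ∫ y, q x y * g t y ∂ν)
    (s n : ℕ) {h w : X → ℝ} (hh : BddMeasurable h) (hw : BddMeasurable w)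
    {ε : ℝ} (hε : 0 < ε) (hεw : ∀ x, ε ≤ w x)
    {a b : ℝ} (hab : ∀ x, a * w x ≤ h x ∧ h x ≤ b * w x) :
    ∃ a' b', b' - a' = (1 - σm / σp) ^ (n + 1) * (b - a) ∧
      ∀ x, a' * (∫ y, ell ν q g s n x y * w y ∂ν) ≤ ∫ y, ell ν q g s n x y * h y ∂ν ∧
        ∫ y, ell ν q g s n x y * h y ∂ν ≤ b' * ∫ y, ell ν q g s n x y * w y ∂ν := by
  have hq0 : ∀ x y, 0 ≤ q x y := fun x y => hσm.le.trans (hqb x y).1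
  induction n generalizing h w ε a b with
  | zero =>
    simpa [ell] using transition_contraction hq hσm hqb (hg (s + 1)) (hg0 _) hh hw
      (fun x => hε.le.trans (hεw x))
      (integral_mul_pos hq hσm hqb (hg _) (hg0 _) hw hε hεw hc (hqg _ (by omega))) hab
  | succ n ih =>
    obtain ⟨a₁, b₁, hd, hab₁⟩ := transition_contraction hq hσm hqb (hg (s + n + 2)) (hg0 _) hh hw
      (fun x => hε.le.trans (hεw x))
      (integral_mul_pos hq hσm hqb (hg _) (hg0 _) hw hε hεw hc (hqg _ (by omega))) hab
    simp only [integral_ell_succ hq hg s n _ hw, integral_ell_succ hq hg s n _ hh]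
    rw [pow_succ, mul_assoc, ← hd]
    exact ih (bddMeasurable_transition hq (hg _) hh) (bddMeasurable_transition hq (hg _) hw)
      (mul_pos hε hc)
      (fun z => mul_le_transition hq hq0 (hg _) (hg0 _) hw hε.le hεw (hqg _ (by omega) z)) hab₁

end Kernel

/-- Second-moment bound for a centred function `H` whose ratio to a weight `T` of bounded
relative variation lies in `[a, b]`. -/
theorem integral_sq_div_sq_le {X : Type*} [MeasurableSpace X] {μ : Measure X}
    [IsFiniteMeasure μ] {σm σp c a b : ℝ} (hσm : 0 < σm) (hc : 0 < c) {ω H T : X → ℝ}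
    (hω : BddMeasurable ω) (hH : BddMeasurable H) (hT : BddMeasurable T)
    (hω0 : ∀ x, 0 ≤ ω x) (hT0 : ∀ x, 0 ≤ T x) (hωT : 0 < ∫ x, ω x * T x ∂μ)
    (hcω : c ≤ ∫ x, ω x ∂μ) (hTT : ∀ x x', σm * T x ≤ σp * T x')
    (hab : ∀ x, a * T x ≤ H x ∧ H x ≤ b * T x) (hzero : ∫ x, ω x * H x ∂μ = 0) :
    (∫ x, ω x ^ 2 * H x ^ 2 ∂μ) / (∫ x, ω x * T x ∂μ) ^ 2 ≤
      (⨆ x, |ω x|) / c * (σp / σm) * (b - a) ^ 2 := by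
  set D := ∫ x, ω x * T x ∂μ with hD
  set W := ⨆ x, |ω x|
  have hωW : ∀ x, ω x ≤ W := fun x => by
    obtain ⟨K, hK⟩ := hω.2
    exact (le_abs_self _).trans
      (le_ciSup (f := fun x => |ω x|) ⟨K, Set.forall_mem_range.2 hK⟩ x)
  have hW : 0 ≤ W := Real.iSup_nonneg fun x => abs_nonneg _
  have hiωT := (hω.mul hT).integrable μ
  have hiωH := (hω.mul hH).integrable μ
  have ha : a ≤ 0 := by
    have h1 : a * D ≤ 0 := by
      rw [← hzero, hD, ← integral_const_mul]
      refine integral_mono (hiωT.const_mul a) hiωH fun x => ?_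
      linarith [mul_le_mul_of_nonneg_left (hab x).1 (hω0 x)]
    exact nonpos_of_mul_nonpos_left h1 hωT
  have hb : 0 ≤ b := by
    have h1 : 0 ≤ b * D := by
      rw [← hzero, hD, ← integral_const_mul]
      refine integral_mono hiωH (hiωT.const_mul b) fun x => ?_
      linarith [mul_le_mul_of_nonneg_left (hab x).2 (hω0 x)]
    exact nonneg_of_mul_nonneg_left h1 hωT
  have hHT : ∀ x, H x ^ 2 ≤ (b - a) ^ 2 * T x ^ 2 := fun x => by
    rw [← mul_pow]
    refine sq_le_sq' ?_ ?_
    · nlinarith [(hab x).1, mul_nonneg hb (hT0 x)]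
    · nlinarith [(hab x).2, mul_nonneg (neg_nonneg.2 ha) (hT0 x)]
  have hTD : ∀ x, T x ≤ σp / σm * D / c := fun x => by
    have h1 : σm * T x * ∫ x', ω x' ∂μ ≤ σp * D := by
      rw [hD, ← integral_const_mul, ← integral_const_mul]
      refine integral_mono ((hω.integrable μ).const_mul _) (hiωT.const_mul _) fun x' => ?_
      linarith [mul_le_mul_of_nonneg_left (hTT x x') (hω0 x')]
    have h2 := mul_le_mul_of_nonneg_left hcω (mul_nonneg hσm.le (hT0 x))
    rw [le_div_iff₀ hc, div_mul_eq_mul_div, le_div_iff₀ hσm]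
    linarith
  rw [div_le_iff₀ (by positivity)]
  calc ∫ x, ω x ^ 2 * H x ^ 2 ∂μ
      ≤ ∫ x, W * (b - a) ^ 2 * (σp / σm * D / c) * (ω x * T x) ∂μ := by
        refine integral_mono ?_ (hiωT.const_mul _) fun x => ?_
        · simpa only [sq] using ((hω.mul hω).mul (hH.mul hH)).integrable μ
        calc ω x ^ 2 * H x ^ 2 ≤ (W * ω x) * ((b - a) ^ 2 * T x ^ 2) := by
              refine mul_le_mul ?_ (hHT x) (sq_nonneg _) (mul_nonneg hW (hω0 x))
              rw [sq]
              exact mul_le_mul_of_nonneg_right (hωW x) (hω0 x)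
          _ = (W * (b - a) ^ 2 * (ω x * T x)) * T x := by ring
          _ ≤ (W * (b - a) ^ 2 * (ω x * T x)) * (σp / σm * D / c) :=
              mul_le_mul_of_nonneg_left (hTD x)
                (mul_nonneg (mul_nonneg hW (sq_nonneg _)) (mul_nonneg (hω0 x) (hT0 x)))
          _ = _ := by ring
    _ = W / c * (σp / σm) * (b - a) ^ 2 * D ^ 2 := by
        rw [integral_const_mul, ← hD]
        ring

theorem stmt_11 {X : Type*} [MeasurableSpace X] (ν : Measure X) (hν : ν Set.univ = 1)
    (σm σp cm : ℝ) (hσm : 0 < σm) (hσmp : σm ≤ σp) (hcm : 0 < cm)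
    (q : X → X → ℝ) (hqmeas : Measurable fun pr : X × X => q pr.1 pr.2)
    (hq : ∀ x y, σm ≤ q x y ∧ q x y ≤ σp)
    (χ : Measure X) [IsProbabilityMeasure χ]
    (g : ℕ → X → ℝ) (hgmeas : ∀ t, Measurable (g t))
    (hg0 : ∀ t x, 0 ≤ g t x) (hgb : ∃ K, ∀ t x, g t x ≤ K)
    (hχg0 : cm ≤ ∫ x, g 0 x ∂χ)
    (hqg : ∀ t, 1 ≤ t → ∀ x, cm ≤ ∫ y, q x y * g t y ∂ν)
    (ρ₀ : Measure X) [IsProbabilityMeasure ρ₀]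
    (d0 : X → ℝ) (hd0meas : Measurable d0) (hd00 : ∀ x, 0 ≤ d0 x)
    (hac : χ = ρ₀.withDensity fun x => ENNReal.ofReal (d0 x))
    (hw0b : ∃ K, ∀ x, |d0 x * g 0 x| ≤ K)
    (s : ℕ) (hs : 1 ≤ s)
    (h : X → ℝ) (hhm : Measurable h) (hhb : ∃ K, ∀ x, |h x| ≤ K)
    (hzero : philt ν χ q g s h = 0) :
    V0 ν ρ₀ χ q g d0 s h ≤
      ((⨆ x, |d0 x * g 0 x|) / cm) * (σp / σm) * (1 - σm / σp) ^ (2 * s) * osc h ^ 2 := by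
  have : IsProbabilityMeasure ν := ⟨hν⟩
  obtain ⟨n, rfl⟩ : ∃ n, s = n + 1 := ⟨s - 1, by omega⟩
  have hqB : BddMeasurable fun p : X × X => q p.1 p.2 :=
    ⟨hqmeas, σp, fun p => by
      rw [abs_of_nonneg (hσm.le.trans (hq _ _).1)]
      exact (hq _ _).2⟩
  have hgB : ∀ t, BddMeasurable (g t) := fun t => by
    obtain ⟨K, hK⟩ := hgb
    exact ⟨hgmeas t, K, fun x => by
      rw [abs_of_nonneg (hg0 t x)]
      exact hK t x⟩
  have hhB : BddMeasurable h := ⟨hhm, hhb⟩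
  have hωB : BddMeasurable fun x => d0 x * g 0 x := ⟨hd0meas.mul (hgmeas 0), hw0b⟩
  have hω0 : ∀ x, 0 ≤ d0 x * g 0 x := fun x => mul_nonneg (hd00 x) (hg0 0 x)
  have hχ : ∀ f : X → ℝ, ∫ x, g 0 x * f x ∂χ = ∫ x, d0 x * g 0 x * f x ∂ρ₀ := fun f => by
    rw [hac, integral_withDensity_eq_integral_toReal_smul (by fun_prop) (by simp)]
    simp [ENNReal.toReal_ofReal, hd00, mul_assoc]
  have hLop : ∀ x f, Lop ν q g 0 (n + 1) x f = ∫ y, ell ν q g 0 n x y * f y ∂ν := fun x f => by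
    simp [Lop, ellST]
  have hLB : ∀ {f}, BddMeasurable f →
      BddMeasurable fun x => ∫ y, ell ν q g 0 n x y * f y ∂ν := fun {f} hf =>
    BddMeasurable.integral_prod (F := fun p : X × X => ell ν q g 0 n p.1 p.2 * f p.2)
      ((bddMeasurable_ell hqB hgB 0 n).mul (hf.comp measurable_snd)) ν
  have hLh := hLB hhB
  have hL1 := hLB (.const 1)
  have hLpos : ∀ x, cm ^ (n + 1) ≤ ∫ y, ell ν q g 0 n x y * 1 ∂ν := fun x => by
    simpa using mul_pow_le_integral_ell hqB hgB (fun x y => hσm.le.trans (hq x y).1) hg0 hcm.le hqg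
      0 n (.const 1) zero_le_one (fun _ => le_rfl) x
  have hLcmp : ∀ x x', σm * (∫ y, ell ν q g 0 n x y * 1 ∂ν) ≤
      σp * ∫ y, ell ν q g 0 n x' y * 1 ∂ν := fun x x' => by
    have hint : ∀ a, Integrable (fun y => ell ν q g 0 n a y * 1) ν := fun a =>
      (((bddMeasurable_ell hqB hgB 0 n).comp (e := fun z => (a, z)) (by fun_prop)).mul
        (.const 1)).integrable ν
    rw [← integral_const_mul, ← integral_const_mul]
    refine integral_mono ((hint x).const_mul _) ((hint x').const_mul _) fun y => ?_
    simpa using mul_ell_le_mul_ell hqB hgB hσm hq hg0 0 n x x' y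
  obtain ⟨a, b, hba, hab⟩ := ell_contraction hqB hgB hσm hq hg0 hcm hqg 0 n hhB (.const 1)
    one_pos (fun _ => le_rfl) (a := ⨅ z, h z) (b := (⨅ z, h z) + osc h)
    (by simpa using le_iInf_add_osc hhb)
  simp only [philt, V0, hLop, hχ] at hzero ⊢
  have hcω : cm ≤ ∫ x, d0 x * g 0 x ∂ρ₀ := by
    simpa using hχg0.trans_eq (by simpa using hχ fun _ => 1)
  have hD : 0 < ∫ x, d0 x * g 0 x * ∫ y, ell ν q g 0 n x y * 1 ∂ν ∂ρ₀ := by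
    refine (mul_pos hcm (pow_pos hcm (n + 1))).trans_le
      ((mul_le_mul_of_nonneg_right hcω (pow_pos hcm (n + 1)).le).trans ?_)
    rw [← integral_mul_const]
    exact integral_mono ((hωB.integrable _).mul_const _) ((hωB.mul hL1).integrable _) fun x =>
      mul_le_mul_of_nonneg_left (hLpos x) (hω0 x)
  have hmain := integral_sq_div_sq_le hσm hcm hωB hLh hL1 hω0
    (fun x => (pow_pos hcm (n + 1)).le.trans (hLpos x)) hD hcω hLcmp hab
    ((div_eq_zero_iff.1 hzero).resolve_right hD.ne')
  refine hmain.trans_eq ?_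
  rw [hba]
  ring
end
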